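/- Let f be a transcendental self-map of ℂ* and let e ∈ {0,∞}^ℕ. Then any connected component of I_e(f) that is bounded in ℂ* meets J(f). -/

import Mathlib

open Complex Topology Filter Set Function OnePoint

noncomputable section

/-- The chordal (spherical) distance on the Riemann sphere, restricted to finite points. -/
def chordalDist (z w : ℂ) : ℝ :=
  ‖z - w‖ / Real.sqrt ((1 + ‖z‖ ^ 2) * (1 + ‖w‖ ^ 2))

/-- A transcendental self-map of `ℂ* = ℂ \ {0}`: a holomorphic self-map of the punctured
plane with essential singularities at `0` and `∞`; equivalently, on `ℂ*` it has the form
`z ^ m * exp (g z + h z⁻¹)` for some `m : ℤ` and nonconstant entire functions `g, h`. -/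
def IsTranscendentalSelfMapCStar (f : ℂ → ℂ) : Prop :=
  ∃ (m : ℤ) (g h : ℂ → ℂ),
    Differentiable ℂ g ∧ Differentiable ℂ h ∧
    (¬ ∃ c : ℂ, ∀ z, g z = c) ∧ (¬ ∃ c : ℂ, ∀ z, h z = c) ∧
    ∀ z : ℂ, z ≠ 0 → f z = z ^ m * Complex.exp (g z + h z⁻¹)

/-- The escaping set `I(f)` of a self-map of the punctured plane: points whose orbit
accumulates only at `0` and `∞`. -/
def escapingSet (f : ℂ → ℂ) : Set ℂ :=
  {z | z ≠ 0 ∧ ∀ ε : ℝ, 0 < ε → ∃ N : ℕ, ∀ n ≥ N,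
    ‖f^[n] z‖ < ε ∨ 1 / ε < ‖f^[n] z‖}

/-- The little escaping set `I_e(f)` with essential itinerary `e` (where `true` stands for the
symbol `∞` and `false` for the symbol `0`). -/
def littleEscapingSet (f : ℂ → ℂ) (e : ℕ → Bool) : Set ℂ :=
  {z | z ∈ escapingSet f ∧ ∃ ℓ k : ℕ, ∀ n : ℕ,
    (1 < ‖f^[n + ℓ] z‖ ↔ e (n + k) = true)}

/-- The immediate little escaping set `Ĩ_e(f)`. -/
def immediateLittleEscapingSet (f : ℂ → ℂ) (e : ℕ → Bool) : Set ℂ :=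
  {z | z ∈ escapingSet f ∧ ∃ ℓ : ℕ, ∀ n : ℕ,
    (1 < ‖f^[n + ℓ] z‖ ↔ e (n + ℓ) = true)}

/-- The Fatou set of a self-map of the punctured plane: points of `ℂ*` with a neighbourhood
(inside `ℂ*`) on which the family of iterates is equicontinuous w.r.t. the chordal metric. -/
def FatouSet (f : ℂ → ℂ) : Set ℂ :=
  {z | z ≠ 0 ∧ ∃ U : Set ℂ, IsOpen U ∧ z ∈ U ∧ (∀ w ∈ U, w ≠ 0) ∧
    ∀ w ∈ U, ∀ ε : ℝ, 0 < ε → ∃ δ : ℝ, 0 < δ ∧ ∀ w' ∈ U,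
      chordalDist w w' < δ → ∀ n : ℕ, chordalDist (f^[n] w) (f^[n] w') < ε}

/-- The Julia set `J(f) = ℂ* \ F(f)`. -/
def JuliaSet (f : ℂ → ℂ) : Set ℂ := {z : ℂ | z ≠ 0} \ FatouSet f

/-- A Fatou component: a connected component of the Fatou set. -/
def IsFatouComponent (f : ℂ → ℂ) (U : Set ℂ) : Prop :=
  ∃ z ∈ FatouSet f, U = connectedComponentIn (FatouSet f) z

/-- A wandering domain: a Fatou component `U` such that the Fatou components containing the
iterated images `fⁿ(U)` are pairwise distinct. -/
def IsWanderingDomain (f : ℂ → ℂ) (U : Set ℂ) : Prop :=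
  IsFatouComponent f U ∧ ∃ V : ℕ → Set ℂ, V 0 = U ∧
    (∀ n, IsFatouComponent f (V n)) ∧
    (∀ n, f '' V n ⊆ V (n + 1)) ∧ Function.Injective V

/-- A set is bounded in `ℂ*` if it lies in some closed annulus `{r ≤ |z| ≤ R}`. -/
def BoundedInCStar (X : Set ℂ) : Prop :=
  ∃ r R : ℝ, 0 < r ∧ r ≤ R ∧ X ⊆ {z : ℂ | r ≤ ‖z‖ ∧ ‖z‖ ≤ R}

/-- The boundary of a subset of `ℂ*` taken in `ℂ*`. -/
def boundaryInCStar (G : Set ℂ) : Set ℂ := frontier G \ {0}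

/-- The set `I(f) ∪ {0, ∞}` regarded as a subset of the Riemann sphere `ℂ̂ = ℂ ∪ {∞}`. -/
def escapingSphere (f : ℂ → ℂ) : Set (OnePoint ℂ) :=
  ((fun z : ℂ => (z : OnePoint ℂ)) '' escapingSet f) ∪ {((0 : ℂ) : OnePoint ℂ), ∞}

/-- The set `I_e(f) ∪ {0, ∞}` regarded as a subset of the Riemann sphere. -/
def littleEscapingSphere (f : ℂ → ℂ) (e : ℕ → Bool) : Set (OnePoint ℂ) :=
  ((fun z : ℂ => (z : OnePoint ℂ)) '' littleEscapingSet f e) ∪ {((0 : ℂ) : OnePoint ℂ), ∞}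

/-- A subset of the sphere has exactly two connected components. -/
def HasExactlyTwoComponents (K : Set (OnePoint ℂ)) : Prop :=
  ∃ x ∈ K, ∃ y ∈ K, connectedComponentIn K x ≠ connectedComponentIn K y ∧
    ∀ z ∈ K, connectedComponentIn K z = connectedComponentIn K x ∨
      connectedComponentIn K z = connectedComponentIn K y

/-- A domain `U ⊆ ℂ*` is doubly connected if its complement in the Riemann sphere has
exactly two connected components. -/
def DoublyConnected (U : Set ℂ) : Prop :=
  HasExactlyTwoComponents (((fun z : ℂ => (z : OnePoint ℂ)) '' U)ᶜ)

/-- A transcendental entire function. -/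
def IsTranscendentalEntire (f : ℂ → ℂ) : Prop :=
  Differentiable ℂ f ∧ ¬ ∃ p : Polynomial ℂ, ∀ z, f z = p.eval z

/-- The Fatou set of an entire function. -/
def FatouSetEntire (f : ℂ → ℂ) : Set ℂ :=
  {z | ∃ U : Set ℂ, IsOpen U ∧ z ∈ U ∧
    ∀ w ∈ U, ∀ ε : ℝ, 0 < ε → ∃ δ : ℝ, 0 < δ ∧ ∀ w' ∈ U,
      chordalDist w w' < δ → ∀ n : ℕ, chordalDist (f^[n] w) (f^[n] w') < ε}

/-- The Julia set of an entire function. -/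
def JuliaSetEntire (f : ℂ → ℂ) : Set ℂ := (FatouSetEntire f)ᶜ

/-- `f` has a finite asymptotic value. -/
def HasFiniteAsymptoticValue (f : ℂ → ℂ) : Prop :=
  ∃ (a : ℂ) (γ : ℝ → ℂ), ContinuousOn γ (Set.Ici (0 : ℝ)) ∧
    Tendsto (fun t => ‖γ t‖) atTop atTop ∧
    Tendsto (fun t => f (γ t)) atTop (nhds a)

/-- A continuous function with the super-mean-value property on a bounded open set takes, near the
boundary, values not exceeding its value at any given interior point. -/
theorem exists_near_boundary_le_of_circleAverage_le {Ω : Set ℂ}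
    (hb : Bornology.IsBounded Ω) {G : ℂ → ℝ} (hG : ContinuousOn G Ω)
    (hmean : ∀ c r, 0 < r → Metric.closedBall c r ⊆ Ω → Real.circleAverage G c r ≤ G c)
    {z₀ : ℂ} (hz₀ : z₀ ∈ Ω) {η : ℝ} (hη : 0 < η) :
    ∃ ζ ∈ Ω, Metric.infDist ζ Ωᶜ < η ∧ G ζ ≤ G z₀ := by
  by_contra! hcon
  have hz₀η : η ≤ Metric.infDist z₀ Ωᶜ := by
    by_contra! h
    exact lt_irrefl _ (hcon z₀ hz₀ h)
  set K : Set ℂ := {z | η ≤ Metric.infDist z Ωᶜ} with hK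
  have hball : ∀ z ∈ K, Metric.closedBall z (η / 2) ⊆ Ω := by
    intro z hz w hw
    by_contra hwΩ
    have h1 : Metric.infDist z Ωᶜ ≤ dist z w := Metric.infDist_le_dist_of_mem hwΩ
    rw [Metric.mem_closedBall, dist_comm] at hw
    have h2 : η ≤ Metric.infDist z Ωᶜ := hz
    linarith
  have hKΩ : K ⊆ Ω := fun z hz => hball z hz (Metric.mem_closedBall_self (by positivity))
  have hKclosed : IsClosed K := isClosed_le continuous_const (Metric.continuous_infDist_pt _)
  have hKc : IsCompact K := Metric.isCompact_of_isClosed_isBounded hKclosed (hb.subset hKΩ)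
  obtain ⟨p, hpK, hpmin⟩ := hKc.exists_isMinOn ⟨z₀, hz₀η⟩ (hG.mono hKΩ)
  have hpz₀ : G p ≤ G z₀ := hpmin hz₀η
  have hge : ∀ w ∈ Ω, G p ≤ G w := by
    intro w hw
    by_cases hwK : w ∈ K
    · exact hpmin hwK
    · exact hpz₀.trans (hcon w hw (not_le.1 hwK)).le
  have hMclosed : IsClosed (K ∩ G ⁻¹' {G p}) :=
    (hG.mono hKΩ).preimage_isClosed_of_isClosed hKclosed isClosed_singleton
  obtain ⟨q, ⟨hqK, hqG⟩, hqmax⟩ :=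
    (hKc.of_isClosed_subset hMclosed inter_subset_left).exists_isMaxOn ⟨p, hpK, rfl⟩
      Complex.continuous_re.continuousOn
  have hqG' : G q = G p := hqG
  have hr : 0 < η / 2 := by positivity
  have hcm : ∀ t, circleMap q (η / 2) t ∈ Ω := fun t =>
    hball q hqK (circleMap_mem_closedBall q hr.le t)
  have hcont : Continuous fun t => G (circleMap q (η / 2) t) :=
    hG.comp_continuous (continuous_circleMap q (η / 2)) hcm
  have hstrict : 0 < G (circleMap q (η / 2) 0) - G p := by
    have hmem := hcm 0
    by_cases hK0 : circleMap q (η / 2) 0 ∈ K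
    · rcases (hge _ hmem).lt_or_eq with h | h
      · linarith
      · have h3 : (circleMap q (η / 2) 0).re ≤ q.re := hqmax ⟨hK0, h.symm⟩
        simp only [circleMap, ofReal_zero, zero_mul, Complex.exp_zero, mul_one,
          Complex.add_re, Complex.ofReal_re] at h3
        linarith
    · linarith [hcon _ hmem (not_le.1 hK0)]
  have hpos : 0 < ∫ t in (0 : ℝ)..2 * Real.pi, (G (circleMap q (η / 2) t) - G p) :=
    intervalIntegral.integral_pos (by positivity) (hcont.sub continuous_const).continuousOn
      (fun t _ => sub_nonneg.2 (hge _ (hcm t))) ⟨0, ⟨le_rfl, by positivity⟩, hstrict⟩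
  rw [intervalIntegral.integral_sub (hcont.intervalIntegrable _ _) (by simp)] at hpos
  have hle := hmean q (η / 2) hr (hball q hqK)
  rw [Real.circleAverage_def, smul_eq_mul, inv_mul_le_iff₀ (by positivity), hqG'] at hle
  simp only [intervalIntegral.integral_const, sub_zero, smul_eq_mul] at hpos
  linarith

/-- The angles in `[0, 2π]` of the points of the circle of radius `ρ` about `0` lying in `V`. -/
def arcAngles (V : Set ℂ) (ρ : ℝ) : Set ℝ :=
  {t | t ∈ Icc 0 (2 * Real.pi) ∧ circleMap 0 ρ t ∈ V}

/-- A nonnegative function, superharmonic on the open set `V`, that is at least `log 2` on the disc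
of radius `R` and, far away, is small when `V` covers little of the circle of radius `2 * R`. -/
def barrier (V : Set ℂ) (R : ℝ) (w : ℂ) : ℝ :=
  (2 * Real.pi)⁻¹ * (∫ t in Icc 0 (2 * Real.pi) \ arcAngles V (2 * R),
      (Real.log ‖circleMap 0 (2 * R) t - w‖ - Real.log (max R ‖w‖))) +
    (2 * Real.pi)⁻¹ * (MeasureTheory.volume.real (arcAngles V (2 * R)) * Real.log 3)

theorem measurableSet_arcAngles {V : Set ℂ} (hV : IsOpen V) (ρ : ℝ) :
    MeasurableSet (arcAngles V ρ) :=
  measurableSet_Icc.inter (hV.preimage (continuous_circleMap 0 ρ)).measurableSet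

theorem isCompact_Icc_diff_arcAngles {V : Set ℂ} (hV : IsOpen V) (ρ : ℝ) :
    IsCompact (Icc 0 (2 * Real.pi) \ arcAngles V ρ) := by
  have h : Icc 0 (2 * Real.pi) \ arcAngles V ρ =
      Icc 0 (2 * Real.pi) ∩ circleMap 0 ρ ⁻¹' Vᶜ := by
    ext t
    simp only [arcAngles, Set.mem_sdiff, mem_inter_iff, mem_preimage, mem_compl_iff, mem_ofPred_eq]
    tauto
  rw [h]
  exact isCompact_Icc.inter_right (hV.isClosed_compl.preimage (continuous_circleMap 0 ρ))

theorem arcAngles_subset (V : Set ℂ) (ρ : ℝ) : arcAngles V ρ ⊆ Icc 0 (2 * Real.pi) :=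
  fun _ ht => ht.1

theorem integrableOn_log_norm_circleMap_sub (ρ : ℝ) (w : ℂ) :
    MeasureTheory.IntegrableOn (fun t => Real.log ‖circleMap 0 ρ t - w‖)
      (Icc 0 (2 * Real.pi)) := by
  have h := circleIntegrable_log_norm_sub_const (a := w) (c := 0) ρ
  rw [CircleIntegrable, intervalIntegrable_iff_integrableOn_Icc_of_le (by positivity)] at h
  exact h

theorem integral_log_norm_circleMap_sub {ρ : ℝ} (hρ : 0 < ρ) (w : ℂ) :
    ∫ t in Icc 0 (2 * Real.pi), Real.log ‖circleMap 0 ρ t - w‖ =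
      2 * Real.pi * Real.log (max ρ ‖w‖) := by
  have h := circleAverage_log_norm_sub_const_eq_log_radius_add_posLog (c := 0) (a := w) hρ.ne'
  rw [Real.circleAverage_def, smul_eq_mul, intervalIntegral.integral_of_le (by positivity),
    ← MeasureTheory.integral_Icc_eq_integral_Ioc, inv_mul_eq_iff_eq_mul₀ (by positivity)] at h
  rw [h, zero_sub, norm_neg]
  congr 1
  rcases le_total ρ ‖w‖ with hw | hw
  · have h1 : 1 ≤ |ρ⁻¹ * ‖w‖| := by
      rw [abs_of_nonneg (by positivity), inv_mul_eq_div, one_le_div hρ]; exact hw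
    rw [Real.posLog_eq_log h1, max_eq_right hw,
      Real.log_mul (by positivity) (hρ.trans_le hw).ne', Real.log_inv]
    ring
  · have h1 : |ρ⁻¹ * ‖w‖| ≤ 1 := by
      rw [abs_of_nonneg (by positivity), inv_mul_eq_div, div_le_one hρ]; exact hw
    rw [(Real.posLog_eq_zero_iff _).2 h1, max_eq_left hw, add_zero]

theorem barrier_eq {V : Set ℂ} (hV : IsOpen V) {R : ℝ} (hR : 1 ≤ R) (w : ℂ) :
    barrier V R w = (Real.log (max (2 * R) ‖w‖) - Real.log (max R ‖w‖)) +
      (2 * Real.pi)⁻¹ * ∫ t in arcAngles V (2 * R),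
        (Real.log 3 - (Real.log ‖circleMap 0 (2 * R) t - w‖ - Real.log (max R ‖w‖))) := by
  have hi : MeasureTheory.IntegrableOn
      (fun t => Real.log ‖circleMap 0 (2 * R) t - w‖ - Real.log (max R ‖w‖))
      (Icc 0 (2 * Real.pi)) :=
    (integrableOn_log_norm_circleMap_sub (2 * R) w).sub
      (MeasureTheory.integrableOn_const measure_Icc_lt_top.ne)
  have hfin : MeasureTheory.volume (arcAngles V (2 * R)) ≠ ⊤ :=
    ((MeasureTheory.measure_mono (arcAngles_subset V (2 * R))).trans_lt
      measure_Icc_lt_top).ne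
  rw [barrier, MeasureTheory.setIntegral_sdiff (measurableSet_arcAngles hV _) hi
      (arcAngles_subset V _),
    MeasureTheory.integral_sub (integrableOn_log_norm_circleMap_sub (2 * R) w)
      (MeasureTheory.integrableOn_const measure_Icc_lt_top.ne).integrable,
    integral_log_norm_circleMap_sub (by linarith) w,
    MeasureTheory.integral_sub (MeasureTheory.integrableOn_const hfin).integrable
      (hi.mono_set (arcAngles_subset V _))]
  simp only [MeasureTheory.setIntegral_const, smul_eq_mul]
  have hv : MeasureTheory.volume.real (Icc 0 (2 * Real.pi)) = 2 * Real.pi := by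
    rw [Real.volume_real_Icc_of_le (by positivity), sub_zero]
  rw [hv]
  field_simp
  ring

theorem log_norm_circleMap_sub_le {R : ℝ} (hR : 1 ≤ R) (w : ℂ) (t : ℝ) :
    Real.log ‖circleMap 0 (2 * R) t - w‖ - Real.log (max R ‖w‖) ≤ Real.log 3 := by
  have hm : 1 ≤ max R ‖w‖ := hR.trans (le_max_left _ _)
  rcases (norm_nonneg (circleMap 0 (2 * R) t - w)).eq_or_lt with h | h
  · rw [← h, Real.log_zero]
    linarith [Real.log_nonneg hm, Real.log_pos (show (1 : ℝ) < 3 by norm_num)]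
  · rw [sub_le_iff_le_add, ← Real.log_mul (by norm_num) (by positivity)]
    refine Real.log_le_log h ((norm_sub_le _ _).trans ?_)
    rw [norm_circleMap_zero, abs_of_nonneg (by linarith)]
    linarith [le_max_left R ‖w‖, le_max_right R ‖w‖]

theorem le_barrier {V : Set ℂ} (hV : IsOpen V) {R : ℝ} (hR : 1 ≤ R) (w : ℂ) :
    Real.log (max (2 * R) ‖w‖) - Real.log (max R ‖w‖) ≤ barrier V R w := by
  rw [barrier_eq hV hR, le_add_iff_nonneg_right]
  refine mul_nonneg (by positivity) (MeasureTheory.integral_nonneg fun t => ?_)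
  exact sub_nonneg.2 (log_norm_circleMap_sub_le hR w t)

theorem barrier_nonneg {V : Set ℂ} (hV : IsOpen V) {R : ℝ} (hR : 1 ≤ R) (w : ℂ) :
    0 ≤ barrier V R w := by
  refine le_trans (sub_nonneg.2 ?_) (le_barrier hV hR w)
  have : 0 < max R ‖w‖ := lt_max_of_lt_left (by linarith)
  exact Real.log_le_log this (max_le_max (by linarith) le_rfl)

theorem log_two_le_barrier {V : Set ℂ} (hV : IsOpen V) {R : ℝ} (hR : 1 ≤ R) {w : ℂ}
    (hw : ‖w‖ ≤ R) : Real.log 2 ≤ barrier V R w := by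
  refine le_trans (le_of_eq ?_) (le_barrier hV hR w)
  rw [max_eq_left (by linarith), max_eq_left hw, Real.log_mul (by norm_num) (by linarith)]
  ring

theorem barrier_le {V : Set ℂ} (hV : IsOpen V) {R : ℝ} (hR : 1 ≤ R) {w : ℂ}
    (hw : 4 * R ≤ ‖w‖) :
    barrier V R w ≤
      (2 * Real.pi)⁻¹ * (MeasureTheory.volume.real (arcAngles V (2 * R)) * Real.log 6) := by
  have hw0 : 0 < ‖w‖ := by linarith
  have hfin : MeasureTheory.volume (arcAngles V (2 * R)) ≠ ⊤ :=
    ((MeasureTheory.measure_mono (arcAngles_subset V (2 * R))).trans_lt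
      measure_Icc_lt_top).ne
  rw [barrier_eq hV hR, max_eq_right (by linarith), max_eq_right (by linarith), sub_self, zero_add,
    ← smul_eq_mul (MeasureTheory.volume.real _), ← MeasureTheory.setIntegral_const]
  refine mul_le_mul_of_nonneg_left ?_ (by positivity)
  refine MeasureTheory.setIntegral_mono ?_ (MeasureTheory.integrableOn_const hfin) fun t => ?_
  · exact (MeasureTheory.integrableOn_const hfin).sub
      (((integrableOn_log_norm_circleMap_sub (2 * R) w).mono_set (arcAngles_subset V _)).sub
        (MeasureTheory.integrableOn_const hfin))
  · have h2 : ‖w‖ / 2 ≤ ‖circleMap 0 (2 * R) t - w‖ := by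
      have h3 := norm_sub_norm_le w (circleMap 0 (2 * R) t)
      rw [norm_circleMap_zero, abs_of_nonneg (by linarith), norm_sub_rev] at h3
      linarith
    have h4 := Real.log_le_log (by positivity) h2
    rw [Real.log_div hw0.ne' (by norm_num)] at h4
    have h6 : Real.log 6 = Real.log 2 + Real.log 3 := by
      rw [← Real.log_mul (by norm_num) (by norm_num)]; norm_num
    simp only [h6]
    linarith

theorem continuousOn_integral_log_norm_sub {V : Set ℂ} (hV : IsOpen V) (ρ : ℝ) :
    ContinuousOn (fun w => ∫ t in Icc 0 (2 * Real.pi) \ arcAngles V ρ,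
      Real.log ‖circleMap 0 ρ t - w‖) V := by
  intro w₀ hw₀
  refine ContinuousAt.continuousWithinAt ?_
  obtain ⟨δ, hδ, hball⟩ := Metric.isOpen_iff.1 hV w₀ hw₀
  have hE := (isCompact_Icc_diff_arcAngles hV ρ).measurableSet
  have hdist : ∀ w ∈ Metric.ball w₀ (δ / 2), ∀ t ∈ Icc 0 (2 * Real.pi) \ arcAngles V ρ,
      δ / 2 ≤ ‖circleMap 0 ρ t - w‖ := by
    intro w hw t ht
    have hnot : circleMap 0 ρ t ∉ Metric.ball w₀ δ := fun h => ht.2 ⟨ht.1, hball h⟩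
    rw [Metric.mem_ball, not_lt] at hnot
    rw [Metric.mem_ball] at hw
    rw [← dist_eq_norm]
    linarith [dist_triangle (circleMap 0 ρ t) w w₀]
  refine MeasureTheory.continuousAt_of_dominated
    (bound := fun _ => |Real.log (δ / 2)| + |Real.log (|ρ| + ‖w₀‖ + δ)|) ?_ ?_ ?_ ?_
  · exact Eventually.of_forall fun w =>
      ((integrableOn_log_norm_circleMap_sub ρ w).mono_set sdiff_subset).aestronglyMeasurable
  · filter_upwards [Metric.ball_mem_nhds w₀ (half_pos hδ)] with w hw
    filter_upwards [MeasureTheory.ae_restrict_mem hE] with t ht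
    have h1 := hdist w hw t ht
    have h2 : ‖circleMap 0 ρ t - w‖ ≤ |ρ| + ‖w₀‖ + δ := by
      refine (norm_sub_le _ _).trans ?_
      rw [norm_circleMap_zero]
      have h3 := norm_sub_norm_le w w₀
      rw [Metric.mem_ball, dist_eq_norm] at hw
      linarith
    have h4 := Real.log_le_log (half_pos hδ) h1
    have h5 := Real.log_le_log (lt_of_lt_of_le (half_pos hδ) h1) h2
    rw [Real.norm_eq_abs, abs_le]
    constructor
    · linarith [neg_abs_le (Real.log (δ / 2)), abs_nonneg (Real.log (|ρ| + ‖w₀‖ + δ))]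
    · linarith [le_abs_self (Real.log (|ρ| + ‖w₀‖ + δ)), abs_nonneg (Real.log (δ / 2))]
  · exact MeasureTheory.integrableOn_const
      ((MeasureTheory.measure_mono sdiff_subset).trans_lt measure_Icc_lt_top).ne
  · filter_upwards [MeasureTheory.ae_restrict_mem hE] with t ht
    have h1 := hdist w₀ (Metric.mem_ball_self (half_pos hδ)) t ht
    exact ContinuousAt.log (by fun_prop) (lt_of_lt_of_le (half_pos hδ) h1).ne'

theorem circleAverage_integral_log_norm_sub {V Ω : Set ℂ} (hV : IsOpen V) (ρ : ℝ)
    {F : ℂ → ℂ} (hF : AnalyticOnNhd ℂ F Ω) (hFV : MapsTo F Ω V) {c : ℂ} {r : ℝ} (hr : 0 < r)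
    (hc : Metric.closedBall c r ⊆ Ω) :
    Real.circleAverage (fun z => ∫ t in Icc 0 (2 * Real.pi) \ arcAngles V ρ,
      Real.log ‖circleMap 0 ρ t - F z‖) c r =
    ∫ t in Icc 0 (2 * Real.pi) \ arcAngles V ρ, Real.log ‖circleMap 0 ρ t - F c‖ := by
  have hEc := isCompact_Icc_diff_arcAngles hV ρ
  have hcm : ∀ θ, circleMap c r θ ∈ Ω := fun θ => hc (circleMap_mem_closedBall c hr.le θ)
  have hne : ∀ t ∈ Icc 0 (2 * Real.pi) \ arcAngles V ρ, ∀ z ∈ Ω, circleMap 0 ρ t - F z ≠ 0 := by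
    intro t ht z hz h
    exact ht.2 ⟨ht.1, sub_eq_zero.1 h ▸ hFV hz⟩
  have hFc : Continuous fun θ => F (circleMap c r θ) :=
    hF.continuousOn.comp_continuous (continuous_circleMap c r) hcm
  have hint : MeasureTheory.IntegrableOn
      (Function.uncurry fun θ t => Real.log ‖circleMap 0 ρ t - F (circleMap c r θ)‖)
      (Icc 0 (2 * Real.pi) ×ˢ (Icc 0 (2 * Real.pi) \ arcAngles V ρ))
      (MeasureTheory.volume.prod MeasureTheory.volume) := by
    refine ContinuousOn.integrableOn_compact (isCompact_Icc.prod hEc) ?_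
    refine ContinuousOn.log ?_ ?_
    · exact (((continuous_circleMap 0 ρ).comp continuous_snd).sub
        (hFc.comp continuous_fst)).norm.continuousOn
    · rintro ⟨θ, t⟩ ⟨_, ht⟩
      exact norm_ne_zero_iff.2 (hne t ht _ (hcm θ))
  rw [MeasureTheory.IntegrableOn, ← MeasureTheory.Measure.prod_restrict] at hint
  rw [Real.circleAverage_def, intervalIntegral.integral_of_le (by positivity),
    ← MeasureTheory.integral_Icc_eq_integral_Ioc, MeasureTheory.integral_integral_swap hint,
    ← MeasureTheory.integral_smul]
  refine MeasureTheory.setIntegral_congr_fun hEc.measurableSet fun t ht => ?_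
  have hharm : InnerProductSpace.HarmonicOnNhd (fun z => Real.log ‖circleMap 0 ρ t - F z‖)
      (Metric.closedBall c |r|) := by
    intro z hz
    rw [abs_of_pos hr] at hz
    exact (analyticAt_const.sub (hF z (hc hz))).harmonicAt_log_norm (hne t ht z (hc hz))
  have hmv := hharm.circleAverage_eq
  rw [Real.circleAverage_def, intervalIntegral.integral_of_le (by positivity),
    ← MeasureTheory.integral_Icc_eq_integral_Ioc] at hmv
  exact hmv

theorem barrier_eq_sub {V : Set ℂ} (R : ℝ) (w : ℂ) :
    barrier V R w = (2 * Real.pi)⁻¹ * (∫ t in Icc 0 (2 * Real.pi) \ arcAngles V (2 * R),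
        Real.log ‖circleMap 0 (2 * R) t - w‖) +
      ((2 * Real.pi)⁻¹ * (MeasureTheory.volume.real (arcAngles V (2 * R)) * Real.log 3) -
        (2 * Real.pi)⁻¹ * MeasureTheory.volume.real (Icc 0 (2 * Real.pi) \ arcAngles V (2 * R)) *
          Real.log (max R ‖w‖)) := by
  rw [barrier, MeasureTheory.integral_sub
    ((integrableOn_log_norm_circleMap_sub (2 * R) w).mono_set sdiff_subset)
    (MeasureTheory.integrableOn_const
      ((MeasureTheory.measure_mono sdiff_subset).trans_lt measure_Icc_lt_top).ne),
    MeasureTheory.setIntegral_const, smul_eq_mul]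
  ring

theorem continuous_log_max_norm {R : ℝ} (hR : 1 ≤ R) :
    Continuous fun w : ℂ => Real.log (max R ‖w‖) :=
  (continuous_const.max continuous_norm).log fun w =>
    (lt_max_of_lt_left (by linarith)).ne'

theorem continuousOn_barrier {V : Set ℂ} (hV : IsOpen V) {R : ℝ} (hR : 1 ≤ R) :
    ContinuousOn (barrier V R) V := by
  have h := continuous_log_max_norm hR
  refine ContinuousOn.congr ?_ fun w _ => barrier_eq_sub R w
  exact (continuousOn_const.mul (continuousOn_integral_log_norm_sub hV _)).add
    (continuousOn_const.sub (continuousOn_const.mul h.continuousOn))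

theorem log_max_norm_le_circleAverage {Ω : Set ℂ} {R : ℝ} (hR : 1 ≤ R) {F : ℂ → ℂ}
    (hF : AnalyticOnNhd ℂ F Ω) (hF0 : ∀ z ∈ Ω, F z ≠ 0) {c : ℂ} {r : ℝ} (hr : 0 < r)
    (hc : Metric.closedBall c r ⊆ Ω) :
    Real.log (max R ‖F c‖) ≤ Real.circleAverage (fun z => Real.log (max R ‖F z‖)) c r := by
  have hsub : Metric.sphere c |r| ⊆ Ω := by
    rw [abs_of_pos hr]; exact Metric.sphere_subset_closedBall.trans hc
  have hcont : ContinuousOn (fun z => Real.log (max R ‖F z‖)) Ω :=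
    (continuous_log_max_norm hR).comp_continuousOn hF.continuousOn
  have hi := (hcont.mono hsub).circleIntegrable'
  have hharm : InnerProductSpace.HarmonicOnNhd (fun z => Real.log ‖F z‖)
      (Metric.closedBall c |r|) := by
    intro z hz
    rw [abs_of_pos hr] at hz
    exact (hF z (hc hz)).harmonicAt_log_norm (hF0 z (hc hz))
  have h1 : Real.log ‖F c‖ ≤ Real.circleAverage (fun z => Real.log (max R ‖F z‖)) c r := by
    rw [← hharm.circleAverage_eq]
    refine Real.circleAverage_mono
      (hharm.continuousOn.mono Metric.sphere_subset_closedBall).circleIntegrable' hi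
      fun z hz => Real.log_le_log (norm_pos_iff.2 (hF0 z (hsub hz))) (le_max_right _ _)
  have h2 : Real.log R ≤ Real.circleAverage (fun z => Real.log (max R ‖F z‖)) c r := by
    rw [← Real.circleAverage_const (Real.log R) c r]
    exact Real.circleAverage_mono (circleIntegrable_const _ _ _) hi
      fun z _ => Real.log_le_log (by linarith) (le_max_left _ _)
  rcases max_choice R ‖F c‖ with h | h <;> rw [h]
  exacts [h2, h1]

theorem circleAverage_barrier_le {V Ω : Set ℂ} (hV : IsOpen V) {R : ℝ} (hR : 1 ≤ R)
    {F : ℂ → ℂ} (hF : AnalyticOnNhd ℂ F Ω) (hF0 : ∀ z ∈ Ω, F z ≠ 0) (hFV : MapsTo F Ω V)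
    {c : ℂ} {r : ℝ} (hr : 0 < r) (hc : Metric.closedBall c r ⊆ Ω) :
    Real.circleAverage (fun z => barrier V R (F z)) c r ≤ barrier V R (F c) := by
  have hsub : Metric.sphere c |r| ⊆ Ω := by
    rw [abs_of_pos hr]; exact Metric.sphere_subset_closedBall.trans hc
  have hcont : ContinuousOn (fun z => Real.log (max R ‖F z‖)) Ω :=
    (continuous_log_max_norm hR).comp_continuousOn hF.continuousOn
  have hi1 : CircleIntegrable (fun z => ∫ t in Icc 0 (2 * Real.pi) \ arcAngles V (2 * R),
      Real.log ‖circleMap 0 (2 * R) t - F z‖) c r :=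
    (((continuousOn_integral_log_norm_sub hV (2 * R)).comp hF.continuousOn hFV).mono
      hsub).circleIntegrable'
  have hi2 := (hcont.mono hsub).circleIntegrable'
  set A := (2 * Real.pi)⁻¹ with hA
  set B := A *
    MeasureTheory.volume.real (Icc 0 (2 * Real.pi) \ arcAngles V (2 * R)) with hB
  have hB0 : 0 ≤ B := by positivity
  simp only [barrier_eq_sub, ← hA, ← hB]
  rw [Real.circleAverage_fun_add, Real.circleAverage_fun_sub, Real.circleAverage_const]
  · have e1 := Real.circleAverage_fun_smul (a := A) (c := c) (R := r)
      (f := fun z => ∫ t in Icc 0 (2 * Real.pi) \ arcAngles V (2 * R),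
        Real.log ‖circleMap 0 (2 * R) t - F z‖)
    have e2 := Real.circleAverage_fun_smul (a := B) (c := c) (R := r)
      (f := fun z => Real.log (max R ‖F z‖))
    simp only [smul_eq_mul] at e1 e2
    rw [e1, e2, circleAverage_integral_log_norm_sub hV _ hF hFV hr hc]
    have := mul_le_mul_of_nonneg_left (log_max_norm_le_circleAverage hR hF hF0 hr hc) hB0
    linarith
  · exact circleIntegrable_const _ _ _
  · exact hi2.const_fun_smul (a := B)
  · exact hi1.const_fun_smul (a := A)
  · exact (circleIntegrable_const _ _ _).fun_sub (hi2.const_fun_smul (a := B))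

/-- The finite partial sums of a summable family beyond a large index are small. -/
theorem exists_forall_sum_Ico_lt {a : ℕ → ℝ} (ha : Summable a) {ε : ℝ} (hε : 0 < ε) :
    ∃ N, ∀ M ≥ N, ∀ k, ∑ n ∈ Finset.Ico M k, a n < ε := by
  obtain ⟨s, hs⟩ := ha.vanishing (Iio_mem_nhds hε)
  refine ⟨s.sup id + 1, fun M hM k => hs _ ?_⟩
  rw [Finset.disjoint_left]
  intro n hn hns
  have h1 : n ≤ s.sup id := Finset.le_sup (f := id) hns
  have h2 := (Finset.mem_Ico.1 hn).1
  omega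

/-- Let `F n` be analytic and zero-free near the closure of a bounded open set `U`, with
`F n → ∞` at a point of `U`. If on every circle about `0` the total angular measure of the images
`F n '' U` is finite, then `F n → ∞` also at some boundary point of `U`. -/
theorem exists_boundary_tendsto_norm_atTop {U : Set ℂ} (hU : IsOpen U)
    (hb : Bornology.IsBounded U) {F : ℕ → ℂ → ℂ} (hF : ∀ n, AnalyticOnNhd ℂ (F n) (closure U))
    (hF0 : ∀ n, ∀ z ∈ closure U, F n z ≠ 0) (hopen : ∀ n, IsOpen (F n '' U))
    (hsum : ∀ ρ, Summable fun n => MeasureTheory.volume.real (arcAngles (F n '' U) ρ))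
    {z₀ : ℂ} (hz₀ : z₀ ∈ U) (hlim : Tendsto (fun n => ‖F n z₀‖) atTop atTop) :
    ∃ ζ ∈ closure U \ U, Tendsto (fun n => ‖F n ζ‖) atTop atTop := by
  have hlog2 : 0 < Real.log 2 := Real.log_pos (by norm_num)
  have hR : ∀ j : ℕ, (1 : ℝ) ≤ (j : ℝ) + 1 := fun j => by linarith [j.cast_nonneg (α := ℝ)]
  have hN : ∀ j : ℕ, ∃ N, (∀ n ≥ N, 4 * ((j : ℝ) + 1) ≤ ‖F n z₀‖) ∧
      ∀ k, ∑ n ∈ Finset.Ico N k, (2 * Real.pi)⁻¹ *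
        (MeasureTheory.volume.real (arcAngles (F n '' U) (2 * ((j : ℝ) + 1))) * Real.log 6) <
          Real.log 2 / 4 * (1 / 2) ^ j := by
    intro j
    obtain ⟨N₁, hN₁⟩ := eventually_atTop.1 (hlim.eventually_ge_atTop (4 * ((j : ℝ) + 1)))
    obtain ⟨N₂, hN₂⟩ := exists_forall_sum_Ico_lt
      (((hsum (2 * ((j : ℝ) + 1))).mul_right (Real.log 6)).mul_left (2 * Real.pi)⁻¹)
      (show 0 < Real.log 2 / 4 * (1 / 2) ^ j by positivity)
    exact ⟨max N₁ N₂, fun n hn => hN₁ n ((le_max_left _ _).trans hn),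
      hN₂ _ (le_max_right _ _)⟩
  choose N hNlarge hNsum using hN
  have hUan : ∀ n, AnalyticOnNhd ℂ (F n) U := fun n => (hF n).mono subset_closure
  have hmaps : ∀ n, MapsTo (F n) U (F n '' U) := fun n => mapsTo_image _ _
  have hcontb : ∀ (j n : ℕ), ContinuousOn (fun z => barrier (F n '' U) ((j : ℝ) + 1) (F n z)) U :=
    fun j n => (continuousOn_barrier (hopen n) (hR j)).comp (hUan n).continuousOn (hmaps n)
  have key : ∀ k : ℕ, ∃ ζ ∈ U, Metric.infDist ζ Uᶜ < 1 / ((k : ℝ) + 1) ∧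
      ∀ j < k, ∀ n, N j ≤ n → n < k → (j : ℝ) + 1 ≤ ‖F n ζ‖ := by
    intro k
    set G : ℂ → ℝ := fun z => ∑ j ∈ Finset.range k, ∑ n ∈ Finset.Ico (N j) k,
      barrier (F n '' U) ((j : ℝ) + 1) (F n z) with hG
    have hGcont : ContinuousOn G U :=
      continuousOn_finsetSum _ fun j _ => continuousOn_finsetSum _ fun n _ => hcontb j n
    have hGmean : ∀ c r, 0 < r → Metric.closedBall c r ⊆ U →
        Real.circleAverage G c r ≤ G c := by
      intro c r hr hc
      have hsub : Metric.sphere c |r| ⊆ U := by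
        rw [abs_of_pos hr]; exact Metric.sphere_subset_closedBall.trans hc
      rw [hG, Real.circleAverage_fun_sum fun j _ => ((continuousOn_finsetSum _
        fun n _ => hcontb j n).mono hsub).circleIntegrable']
      refine Finset.sum_le_sum fun j _ => ?_
      rw [Real.circleAverage_fun_sum fun n _ => ((hcontb j n).mono hsub).circleIntegrable']
      exact Finset.sum_le_sum fun n _ => circleAverage_barrier_le (hopen n) (hR j) (hUan n)
        (fun z hz => hF0 n z (subset_closure hz)) (hmaps n) hr hc
    have hGz₀ : G z₀ < Real.log 2 := by
      calc G z₀ ≤ ∑ j ∈ Finset.range k, Real.log 2 / 4 * (1 / 2) ^ j := by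
            refine Finset.sum_le_sum fun j _ => le_trans ?_ (hNsum j k).le
            exact Finset.sum_le_sum fun n hn => barrier_le (hopen n) (hR j)
              (hNlarge j n (Finset.mem_Ico.1 hn).1)
        _ ≤ Real.log 2 / 4 * 2 := by
            rw [← Finset.mul_sum]
            exact mul_le_mul_of_nonneg_left (sum_geometric_two_le k) (by positivity)
        _ < Real.log 2 := by linarith
    obtain ⟨ζ, hζU, hζd, hζG⟩ := exists_near_boundary_le_of_circleAverage_le hb hGcont hGmean
      hz₀ (show 0 < 1 / ((k : ℝ) + 1) by positivity)
    refine ⟨ζ, hζU, hζd, fun j hj n hjn hnk => ?_⟩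
    by_contra! hlt
    have h1 := log_two_le_barrier (hopen n) (hR j) hlt.le
    have h2 : barrier (F n '' U) ((j : ℝ) + 1) (F n ζ) ≤ G ζ :=
      (Finset.single_le_sum
        (f := fun n => barrier (F n '' U) ((j : ℝ) + 1) (F n ζ))
        (fun m _ => barrier_nonneg (hopen m) (hR j) _) (Finset.mem_Ico.2 ⟨hjn, hnk⟩)).trans
      (Finset.single_le_sum
        (f := fun j : ℕ => ∑ n ∈ Finset.Ico (N j) k, barrier (F n '' U) ((j : ℝ) + 1) (F n ζ))
        (fun i _ => Finset.sum_nonneg fun m _ => barrier_nonneg (hopen m) (hR i) _)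
        (Finset.mem_range.2 hj))
    linarith
  choose ζ hζU hζd hζF using key
  obtain ⟨ξ, hξ, φ, hφ, hφlim⟩ := hb.isCompact_closure.tendsto_subseq
    fun k => subset_closure (hζU k)
  refine ⟨ξ, ⟨hξ, ?_⟩, ?_⟩
  · have hne : (Uᶜ).Nonempty := by
      rw [nonempty_compl]
      rintro rfl
      exact NormedSpace.unbounded_univ ℂ ℂ hb
    have h0 : Metric.infDist ξ Uᶜ ≤ 0 :=
      le_of_tendsto_of_tendsto'
        (((Metric.continuous_infDist_pt (Uᶜ)).tendsto ξ).comp hφlim)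
        (tendsto_one_div_add_atTop_nhds_zero_nat.comp hφ.tendsto_atTop) fun k => (hζd (φ k)).le
    have h1 := (hU.isClosed_compl.mem_iff_infDist_zero hne).2 (le_antisymm h0 Metric.infDist_nonneg)
    exact h1
  · have hlow : ∀ (j n : ℕ), N j ≤ n → (j : ℝ) + 1 ≤ ‖F n ξ‖ := by
      intro j n hjn
      have hc : Tendsto (fun k => ‖F n (ζ (φ k))‖) atTop (𝓝 ‖F n ξ‖) :=
        (((hF n ξ hξ).continuousAt.tendsto).comp hφlim).norm
      refine ge_of_tendsto hc ?_
      filter_upwards [hφ.tendsto_atTop.eventually_gt_atTop (max j n)] with k hk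
      exact hζF _ j ((le_max_left _ _).trans_lt hk) n hjn ((le_max_right _ _).trans_lt hk)
    refine tendsto_atTop.2 fun b => ?_
    obtain ⟨j, hj⟩ := exists_nat_ge b
    filter_upwards [eventually_ge_atTop (N j)] with n hn
    linarith [hlow j n hn]

/-- Two classes of pairwise disjoint open sets cut any circle in arcs of finite total measure. -/
theorem summable_volume_arcAngles {V : ℕ → Set ℂ} (hV : ∀ n, IsOpen (V n)) (b : ℕ → Prop)
    (hdisj : ∀ m n, m ≠ n → (b m ↔ b n) → Disjoint (V m) (V n)) (ρ : ℝ) :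
    Summable fun n => MeasureTheory.volume.real (arcAngles (V n) ρ) := by
  classical
  have aux : ∀ c : ℕ → Prop, (∀ m n, m ≠ n → c m → c n → Disjoint (V m) (V n)) →
      Summable fun n => if c n then MeasureTheory.volume.real (arcAngles (V n) ρ) else 0 := by
    intro c hc
    have h := MeasureTheory.summable_measure_toReal
      (μ := MeasureTheory.volume.restrict (Icc 0 (2 * Real.pi)))
      (f := fun n => if c n then arcAngles (V n) ρ else ∅) ?_ ?_
    · refine h.congr fun n => ?_
      split_ifs with hn
      · rw [MeasureTheory.measureReal_def,
          MeasureTheory.Measure.restrict_eq_self _ (arcAngles_subset _ _)]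
        rfl
      · simp
    · intro n
      split_ifs
      exacts [measurableSet_arcAngles (hV n) ρ, MeasurableSet.empty]
    · intro m n hmn
      simp only [Function.onFun]
      split_ifs with hm hn
      · rw [Set.disjoint_left]
        exact fun t ht ht' => Set.disjoint_left.1 (hc m n hmn hm hn) ht.2 ht'.2
      all_goals simp
  have h1 := aux b fun m n hmn hm hn => hdisj m n hmn (iff_of_true hm hn)
  have h2 := aux (fun n => ¬ b n) fun m n hmn hm hn => hdisj m n hmn (iff_of_false hm hn)
  refine (h1.add h2).congr fun n => ?_
  by_cases hn : b n <;> simp [hn]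

/-- Harnack's inequality (lower bound) for a nonnegative harmonic function on a disc. -/
theorem harnack_lower_bound {h : ℂ → ℝ} {c w : ℂ} {R : ℝ}
    (hh : InnerProductSpace.HarmonicOnNhd h (Metric.closedBall c R))
    (h0 : ∀ z ∈ Metric.sphere c R, 0 ≤ h z) (hw : w ∈ Metric.ball c R) :
    (R - ‖w - c‖) / (R + ‖w - c‖) * h c ≤ h w := by
  have hR : 0 < R := Metric.pos_of_mem_ball hw
  have hcont : ContinuousOn h (Metric.sphere c |R|) := fun z hz =>
    (hh z (Metric.sphere_subset_closedBall (by rwa [abs_of_pos hR] at hz))).1.continuousAt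
      |>.continuousWithinAt
  have hker : ContinuousOn (re ∘ herglotzRieszKernel c w) (Metric.sphere c |R|) :=
    continuous_re.comp_continuousOn (continuousOn_herglotzRieszKernel_sphere hw)
  have h1 := hh.circleAverage_re_herglotzRieszKernel_smul hw
  have h2 : Real.circleAverage h c R = h c :=
    InnerProductSpace.HarmonicOnNhd.circleAverage_eq (by rwa [abs_of_pos hR])
  rw [← h1, ← h2, ← smul_eq_mul, ← Real.circleAverage_fun_smul]
  refine Real.circleAverage_mono
    (hcont.const_smul ((R - ‖w - c‖) / (R + ‖w - c‖))).circleIntegrable' (hker.smul hcont).circleIntegrable' fun z hz => ?_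
  rw [abs_of_pos hR] at hz
  exact mul_le_mul_of_nonneg_right (le_re_herglotzRieszKernel hz hw) (h0 z hz)

theorem chordalDist_comm (a b : ℂ) : chordalDist a b = chordalDist b a := by
  rw [chordalDist, chordalDist, norm_sub_rev, mul_comm]

theorem chordalDist_inv {a b : ℂ} (ha : a ≠ 0) (hb : b ≠ 0) :
    chordalDist a⁻¹ b⁻¹ = chordalDist a b := by
  have ha' := norm_pos_iff.2 ha
  have hb' := norm_pos_iff.2 hb
  have h1 : (1 + ‖a⁻¹‖ ^ 2) * (1 + ‖b⁻¹‖ ^ 2) =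
      ((1 + ‖a‖ ^ 2) * (1 + ‖b‖ ^ 2)) / (‖a‖ * ‖b‖) ^ 2 := by
    rw [norm_inv, norm_inv]
    field_simp
    ring
  rw [chordalDist, chordalDist, h1, Real.sqrt_div (by positivity),
    Real.sqrt_sq (by positivity), inv_sub_inv ha hb, norm_div, norm_mul, norm_sub_rev]
  have : 0 < Real.sqrt ((1 + ‖a‖ ^ 2) * (1 + ‖b‖ ^ 2)) := by positivity
  field_simp

theorem chordalDist_le_norm_sub (a b : ℂ) : chordalDist a b ≤ ‖a - b‖ := by
  refine div_le_self (norm_nonneg _) (Real.one_le_sqrt.2 ?_)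
  nlinarith [sq_nonneg ‖a‖, sq_nonneg ‖b‖, mul_nonneg (sq_nonneg ‖a‖) (sq_nonneg ‖b‖)]

theorem norm_ge_of_chordalDist_lt {a b : ℂ} {M : ℝ} (hM : 1 ≤ M) (hM2 : M ≤ 2)
    (ha : 2 * M ≤ ‖a‖) (hab : chordalDist a b < 1 / 8) : M ≤ ‖b‖ := by
  by_contra! hb
  have hpos : 0 < Real.sqrt ((1 + ‖a‖ ^ 2) * (1 + ‖b‖ ^ 2)) := by positivity
  rw [chordalDist, div_lt_iff₀ hpos] at hab
  have h1 : Real.sqrt ((1 + ‖a‖ ^ 2) * (1 + ‖b‖ ^ 2)) ≤ 4 * ‖a‖ := by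
    rw [Real.sqrt_le_left (by positivity)]
    have h2 : 1 + ‖a‖ ^ 2 ≤ 2 * ‖a‖ ^ 2 := by nlinarith
    have h3 : 1 + ‖b‖ ^ 2 ≤ 5 := by nlinarith [norm_nonneg b]
    nlinarith [sq_nonneg ‖a‖, sq_nonneg ‖b‖]
  have h4 := norm_sub_norm_le a b
  linarith

/-- If analytic zero-free maps `G n` on a disc vary little in the chordal metric, and tend to
`∞` at some point near the centre, then they tend to `∞` at all points near the centre. -/
theorem tendsto_norm_atTop_of_chordalDist_lt {G : ℕ → ℂ → ℂ} {w : ℂ} {r : ℝ}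
    (hG : ∀ n, AnalyticOnNhd ℂ (G n) (Metric.ball w r))
    (hG0 : ∀ n, ∀ x ∈ Metric.ball w r, G n x ≠ 0)
    (hd : ∀ n, ∀ x ∈ Metric.ball w r, chordalDist (G n w) (G n x) < 1 / 8) {x y : ℂ}
    (hx : x ∈ Metric.ball w (r / 4)) (hy : y ∈ Metric.ball w (r / 4))
    (hlim : Tendsto (fun n => ‖G n x‖) atTop atTop) :
    Tendsto (fun n => ‖G n y‖) atTop atTop := by
  have hr4 : 0 < r / 4 := Metric.pos_of_mem_ball hx
  have hsub : Metric.closedBall x (r / 2) ⊆ Metric.ball w r := by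
    intro u hu
    have h1 := Metric.mem_closedBall.1 hu
    have h2 := Metric.mem_ball.1 hx
    exact Metric.mem_ball.2 (by linarith [dist_triangle u x w])
  have hxw : x ∈ Metric.ball w r := Metric.ball_subset_ball (by linarith) hx
  have hyw : y ∈ Metric.ball w r := Metric.ball_subset_ball (by linarith) hy
  have hyx : y ∈ Metric.ball x (r / 2) := by
    rw [Metric.mem_ball] at hx hy ⊢
    linarith [dist_triangle_right y x w]
  have hκ : 0 < (r / 2 - ‖y - x‖) / (r / 2 + ‖y - x‖) := by
    have := mem_ball_iff_norm.1 hyx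
    exact div_pos (by linarith) (by linarith [norm_nonneg (y - x)])
  have hlog : Tendsto (fun n => Real.log ‖G n y‖) atTop atTop := by
    refine tendsto_atTop_mono' _ ?_ ((Real.tendsto_log_atTop.comp hlim).const_mul_atTop hκ)
    filter_upwards [hlim.eventually_ge_atTop 4] with n hn
    have h1 : 2 ≤ ‖G n w‖ := norm_ge_of_chordalDist_lt (by norm_num) le_rfl
      (by linarith) (by rw [chordalDist_comm]; exact hd n x hxw)
    refine harnack_lower_bound (h := fun u => Real.log ‖G n u‖)
      (fun u hu => (hG n u (hsub hu)).harmonicAt_log_norm (hG0 n u (hsub hu)))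
      (fun u hu => Real.log_nonneg ?_) hyx
    exact norm_ge_of_chordalDist_lt le_rfl (by norm_num) (by linarith)
      (hd n u (hsub (Metric.sphere_subset_closedBall hu)))
  refine (Real.tendsto_exp_atTop.comp hlog).congr fun n => ?_
  exact Real.exp_log (norm_pos_iff.2 (hG0 n y hyw))

section PuncturedPlane

theorem IsTranscendentalSelfMapCStar.apply_ne_zero {f : ℂ → ℂ}
    (hf : IsTranscendentalSelfMapCStar f) {z : ℂ} (hz : z ≠ 0) : f z ≠ 0 := by
  obtain ⟨m, g, h, -, -, -, -, hfe⟩ := hf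
  rw [hfe z hz]
  exact mul_ne_zero (zpow_ne_zero _ hz) (exp_ne_zero _)

theorem IsTranscendentalSelfMapCStar.analyticOnNhd {f : ℂ → ℂ}
    (hf : IsTranscendentalSelfMapCStar f) : AnalyticOnNhd ℂ f {0}ᶜ := by
  obtain ⟨m, g, h, hg, hh, -, -, hfe⟩ := hf
  refine DifferentiableOn.analyticOnNhd (fun z hz => ?_) isOpen_compl_singleton
  have hd : DifferentiableAt ℂ (fun z => z ^ m * Complex.exp (g z + h z⁻¹)) z :=
    (differentiableAt_zpow.2 (Or.inl hz)).mul
      ((hg z).add ((hh z⁻¹).comp z (differentiableAt_inv hz))).cexp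
  exact hd.differentiableWithinAt.congr (fun y hy => hfe y hy) (hfe z hz)

theorem iterate_ne_zero {f : ℂ → ℂ} (hf0 : ∀ z, z ≠ 0 → f z ≠ 0) (n : ℕ) {z : ℂ}
    (hz : z ≠ 0) : f^[n] z ≠ 0 := by
  induction n with
  | zero => exact hz
  | succ n ih => rw [iterate_succ_apply']; exact hf0 _ ih

theorem analyticOnNhd_iterate {f : ℂ → ℂ} (hf0 : ∀ z, z ≠ 0 → f z ≠ 0)
    (hfa : AnalyticOnNhd ℂ f {0}ᶜ) (n : ℕ) : AnalyticOnNhd ℂ f^[n] {0}ᶜ := by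
  induction n with
  | zero => exact analyticOnNhd_id
  | succ n ih =>
    rw [iterate_succ']
    exact hfa.comp ih fun z hz => iterate_ne_zero hf0 n hz

theorem isOpen_image_iterate {f : ℂ → ℂ} (hf0 : ∀ z, z ≠ 0 → f z ≠ 0)
    (hfo : ∀ s ⊆ ({0}ᶜ : Set ℂ), IsOpen s → IsOpen (f '' s)) {s : Set ℂ} (hs : s ⊆ {0}ᶜ)
    (hso : IsOpen s) (n : ℕ) : IsOpen (f^[n] '' s) := by
  induction n with
  | zero => simpa using hso
  | succ n ih =>
    rw [iterate_succ', image_comp]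
    refine hfo _ ?_ ih
    rintro _ ⟨z, hz, rfl⟩
    exact iterate_ne_zero hf0 n (hs hz)

theorem isOpen_image_inv {s : Set ℂ} (hs : s ⊆ {0}ᶜ) (hso : IsOpen s) :
    IsOpen ((fun z => z⁻¹) '' s) := by
  rw [image_inv_eq_inv, isOpen_iff_mem_nhds]
  intro z hz
  have hz0 : z ≠ 0 := fun h => hs hz (by simp [h])
  exact (continuousAt_inv₀ hz0).preimage_mem_nhds (hso.mem_nhds hz)

end PuncturedPlane

section Escaping

variable {f : ℂ → ℂ} {e : ℕ → Bool}

theorem apply_mem_littleEscapingSet (hf0 : ∀ z, z ≠ 0 → f z ≠ 0) {z : ℂ} (hz0 : z ≠ 0) :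
    f z ∈ littleEscapingSet f e ↔ z ∈ littleEscapingSet f e := by
  constructor
  · rintro ⟨⟨-, h⟩, ℓ, k, hk⟩
    refine ⟨⟨hz0, fun ε hε => ?_⟩, ℓ + 1, k, fun n => ?_⟩
    · obtain ⟨N, hN⟩ := h ε hε
      refine ⟨N + 1, fun n hn => ?_⟩
      obtain ⟨m, rfl⟩ : ∃ m, n = m + 1 := ⟨n - 1, by omega⟩
      exact hN m (by omega)
    · rw [← hk n, ← add_assoc, iterate_succ_apply]
  · rintro ⟨⟨-, h⟩, ℓ, k, hk⟩
    refine ⟨⟨hf0 z hz0, fun ε hε => ?_⟩, ℓ, k + 1, fun n => ?_⟩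
    · obtain ⟨N, hN⟩ := h ε hε
      exact ⟨N, fun n hn => hN (n + 1) (by omega)⟩
    · rw [← iterate_succ_apply, show (n + ℓ).succ = n + 1 + ℓ by omega, hk,
        show n + 1 + k = n + (k + 1) by omega]

theorem iterate_mem_littleEscapingSet (hf0 : ∀ z, z ≠ 0 → f z ≠ 0) {z : ℂ} (hz0 : z ≠ 0)
    (n : ℕ) : f^[n] z ∈ littleEscapingSet f e ↔ z ∈ littleEscapingSet f e := by
  induction n with
  | zero => rfl
  | succ n ih =>
    rw [iterate_succ_apply', apply_mem_littleEscapingSet hf0 (iterate_ne_zero hf0 n hz0), ih]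

/-- The iterate `fⁿ`, composed with the inversion of `ℂ*` whenever `fⁿ z` lies in the closed unit
disc. -/
def normalizedIterate (f : ℂ → ℂ) (z : ℂ) (n : ℕ) (w : ℂ) : ℂ :=
  open Classical in if 1 < ‖f^[n] z‖ then f^[n] w else (f^[n] w)⁻¹

theorem tendsto_normalizedIterate_self (hf0 : ∀ z, z ≠ 0 → f z ≠ 0) {z : ℂ}
    (hz : z ∈ escapingSet f) : Tendsto (fun n => ‖normalizedIterate f z n z‖) atTop atTop := by
  refine tendsto_atTop.2 fun b => ?_
  have hb : 0 < max b 1 := lt_max_of_lt_right one_pos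
  obtain ⟨N, hN⟩ := hz.2 (1 / max b 1) (by positivity)
  filter_upwards [eventually_ge_atTop N] with n hn
  have h := hN n hn
  rw [one_div_one_div] at h
  refine (le_max_left b 1).trans ?_
  have h1 : 1 / max b 1 ≤ 1 := (div_le_one hb).2 (le_max_right _ _)
  rw [normalizedIterate]
  split_ifs with hc
  · rcases h with h | h
    · linarith
    · exact h.le
  · rcases h with h | h
    · rw [norm_inv, ← one_div, le_div_iff₀ (norm_pos_iff.2 (iterate_ne_zero hf0 n hz.1))]
      rw [lt_div_iff₀ hb] at h
      linarith
    · linarith [le_max_right b 1]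

theorem eventually_one_lt_norm_iff {z w : ℂ}
    (hw : Tendsto (fun n => ‖normalizedIterate f z n w‖) atTop atTop) :
    ∀ᶠ n in atTop, (1 < ‖f^[n] w‖ ↔ 1 < ‖f^[n] z‖) := by
  filter_upwards [hw.eventually_gt_atTop 1] with n hn
  rw [normalizedIterate] at hn
  split_ifs at hn with hc
  · exact iff_of_true hn hc
  · refine iff_of_false (fun h => ?_) hc
    rw [norm_inv] at hn
    exact absurd (inv_lt_one_of_one_lt₀ h) hn.not_gt

theorem mem_littleEscapingSet_of_tendsto (hf0 : ∀ z, z ≠ 0 → f z ≠ 0) {z w : ℂ}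
    (hz : z ∈ littleEscapingSet f e) (hw0 : w ≠ 0)
    (hw : Tendsto (fun n => ‖normalizedIterate f z n w‖) atTop atTop) :
    w ∈ littleEscapingSet f e := by
  obtain ⟨-, ℓ, k, hk⟩ := hz
  refine ⟨⟨hw0, fun ε hε => ?_⟩, ?_⟩
  · obtain ⟨N, hN⟩ := eventually_atTop.1 (hw.eventually_gt_atTop (1 / ε))
    refine ⟨N, fun n hn => ?_⟩
    have h := hN n hn
    rw [normalizedIterate] at h
    split_ifs at h
    · exact Or.inr h
    · left
      rw [norm_inv, ← one_div] at h
      exact (one_div_lt_one_div hε (norm_pos_iff.2 (iterate_ne_zero hf0 n hw0))).1 h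
  · obtain ⟨N, hN⟩ := eventually_atTop.1 (eventually_one_lt_norm_iff hw)
    refine ⟨ℓ + N, k + N, fun n => ?_⟩
    rw [hN _ (by omega), show n + (ℓ + N) = n + N + ℓ by omega, hk,
      show n + N + k = n + (k + N) by omega]

theorem analyticOnNhd_normalizedIterate (hf0 : ∀ z, z ≠ 0 → f z ≠ 0)
    (hfa : AnalyticOnNhd ℂ f {0}ᶜ) (z : ℂ) (n : ℕ) :
    AnalyticOnNhd ℂ (normalizedIterate f z n) {0}ᶜ := by
  unfold normalizedIterate
  split_ifs
  · exact analyticOnNhd_iterate hf0 hfa n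
  · exact (analyticOnNhd_iterate hf0 hfa n).inv fun w hw => iterate_ne_zero hf0 n hw

theorem normalizedIterate_ne_zero (hf0 : ∀ z, z ≠ 0 → f z ≠ 0) (z : ℂ) (n : ℕ) {w : ℂ}
    (hw : w ≠ 0) : normalizedIterate f z n w ≠ 0 := by
  unfold normalizedIterate
  split_ifs
  exacts [iterate_ne_zero hf0 n hw, inv_ne_zero (iterate_ne_zero hf0 n hw)]

theorem chordalDist_normalizedIterate (hf0 : ∀ z, z ≠ 0 → f z ≠ 0) (z : ℂ) (n : ℕ) {v w : ℂ}
    (hv : v ≠ 0) (hw : w ≠ 0) :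
    chordalDist (normalizedIterate f z n v) (normalizedIterate f z n w) =
      chordalDist (f^[n] v) (f^[n] w) := by
  unfold normalizedIterate
  split_ifs
  exacts [rfl, chordalDist_inv (iterate_ne_zero hf0 n hv) (iterate_ne_zero hf0 n hw)]

theorem image_normalizedIterate_of_one_lt {z : ℂ} {n : ℕ} (h : 1 < ‖f^[n] z‖) (s : Set ℂ) :
    normalizedIterate f z n '' s = f^[n] '' s := by
  refine image_congr fun w _ => ?_
  rw [normalizedIterate, if_pos h]

theorem image_normalizedIterate_of_not_one_lt {z : ℂ} {n : ℕ} (h : ¬ 1 < ‖f^[n] z‖)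
    (s : Set ℂ) : normalizedIterate f z n '' s = (fun w => w⁻¹) '' (f^[n] '' s) := by
  rw [image_image]
  refine image_congr fun w _ => ?_
  rw [normalizedIterate, if_neg h]

theorem isOpen_image_normalizedIterate (hf0 : ∀ z, z ≠ 0 → f z ≠ 0)
    (hfo : ∀ s ⊆ ({0}ᶜ : Set ℂ), IsOpen s → IsOpen (f '' s)) {s : Set ℂ} (hs : s ⊆ {0}ᶜ)
    (hso : IsOpen s) (z : ℂ) (n : ℕ) : IsOpen (normalizedIterate f z n '' s) := by
  by_cases h : 1 < ‖f^[n] z‖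
  · rw [image_normalizedIterate_of_one_lt h]
    exact isOpen_image_iterate hf0 hfo hs hso n
  · rw [image_normalizedIterate_of_not_one_lt h]
    refine isOpen_image_inv ?_ (isOpen_image_iterate hf0 hfo hs hso n)
    rintro _ ⟨w, hw, rfl⟩
    exact iterate_ne_zero hf0 n (hs hw)

theorem disjoint_image_normalizedIterate {s : Set ℂ} {z : ℂ} {m n : ℕ}
    (h : 1 < ‖f^[m] z‖ ↔ 1 < ‖f^[n] z‖) (hd : Disjoint (f^[m] '' s) (f^[n] '' s)) :
    Disjoint (normalizedIterate f z m '' s) (normalizedIterate f z n '' s) := by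
  by_cases hm : 1 < ‖f^[m] z‖
  · rwa [image_normalizedIterate_of_one_lt hm, image_normalizedIterate_of_one_lt (h.1 hm)]
  · rw [image_normalizedIterate_of_not_one_lt hm,
      image_normalizedIterate_of_not_one_lt (mt h.2 hm)]
    exact (disjoint_image_iff inv_injective).2 hd

theorem isOpen_FatouSet (f : ℂ → ℂ) : IsOpen (FatouSet f) := by
  rw [isOpen_iff_mem_nhds]
  rintro z ⟨-, U, hU, hzU, hU0, hUe⟩
  filter_upwards [hU.mem_nhds hzU] with w hw
  exact ⟨hU0 w hw, U, hU, hw, hU0, hUe⟩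

/-- Near a point of the Fatou set, either all points or no points have an orbit that escapes
following the same symbols as the orbit of `z`. -/
theorem exists_ball_tendsto_normalizedIterate (hf0 : ∀ z, z ≠ 0 → f z ≠ 0)
    (hfa : AnalyticOnNhd ℂ f {0}ᶜ) (z : ℂ) {w : ℂ} (hw : w ∈ FatouSet f) :
    ∃ r > 0, ∀ x ∈ Metric.ball w r, ∀ y ∈ Metric.ball w r,
      Tendsto (fun n => ‖normalizedIterate f z n x‖) atTop atTop →
      Tendsto (fun n => ‖normalizedIterate f z n y‖) atTop atTop := by
  obtain ⟨hw0, U, hU, hwU, hU0, hUe⟩ := hw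
  obtain ⟨δ, hδ, hδe⟩ := hUe w hwU (1 / 8) (by norm_num)
  obtain ⟨ρ, hρ, hρU⟩ := Metric.isOpen_iff.1 hU w hwU
  have hr : 0 < min ρ δ := lt_min hρ hδ
  have hsub : Metric.ball w (min ρ δ) ⊆ U := (Metric.ball_subset_ball (min_le_left _ _)).trans hρU
  refine ⟨min ρ δ / 4, by positivity, fun x hx y hy => ?_⟩
  refine tendsto_norm_atTop_of_chordalDist_lt (w := w) (r := min ρ δ)
    (fun n => (analyticOnNhd_normalizedIterate hf0 hfa z n).mono fun u hu => hU0 u (hsub hu))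
    (fun n u hu => normalizedIterate_ne_zero hf0 z n (hU0 u (hsub hu))) (fun n u hu => ?_) hx hy
  rw [chordalDist_normalizedIterate hf0 z n hw0 (hU0 u (hsub hu))]
  refine hδe u (hsub hu) ((chordalDist_le_norm_sub w u).trans_lt ?_) n
  rw [← dist_eq_norm, dist_comm]
  exact (Metric.mem_ball.1 hu).trans_le (min_le_right _ _)

theorem tendsto_normalizedIterate_of_mem_preconnected (hf0 : ∀ z, z ≠ 0 → f z ≠ 0)
    (hfa : AnalyticOnNhd ℂ f {0}ᶜ) {z : ℂ} {U : Set ℂ} (hUF : U ⊆ FatouSet f)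
    (hUc : IsPreconnected U) {x : ℂ} (hx : x ∈ U)
    (hlim : Tendsto (fun n => ‖normalizedIterate f z n x‖) atTop atTop) {y : ℂ} (hy : y ∈ U) :
    Tendsto (fun n => ‖normalizedIterate f z n y‖) atTop atTop := by
  set A : Set ℂ := {w | Tendsto (fun n => ‖normalizedIterate f z n w‖) atTop atTop} with hA
  by_contra hyA
  have key : ∀ w ∈ U, ∃ r > 0, Metric.ball w r ⊆ A ∨ Metric.ball w r ⊆ Aᶜ := by
    intro w hw
    obtain ⟨r, hr, h⟩ := exists_ball_tendsto_normalizedIterate hf0 hfa z (hUF hw)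
    refine ⟨r, hr, ?_⟩
    by_cases hwA : w ∈ A
    · exact Or.inl fun v hv => h w (Metric.mem_ball_self hr) v hv hwA
    · exact Or.inr fun v hv hvA => hwA (h v hv w (Metric.mem_ball_self hr) hvA)
  obtain ⟨v, hvU, hv1, hv2⟩ := hUc (interior A) (interior Aᶜ) isOpen_interior isOpen_interior
    (fun w hw => by
      obtain ⟨r, hr, h | h⟩ := key w hw
      · exact Or.inl (mem_interior.2 ⟨_, h, Metric.isOpen_ball, Metric.mem_ball_self hr⟩)
      · exact Or.inr (mem_interior.2 ⟨_, h, Metric.isOpen_ball, Metric.mem_ball_self hr⟩))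
    ⟨x, hx, by
      obtain ⟨r, hr, h | h⟩ := key x hx
      · exact mem_interior.2 ⟨_, h, Metric.isOpen_ball, Metric.mem_ball_self hr⟩
      · exact absurd hlim (h (Metric.mem_ball_self hr))⟩
    ⟨y, hy, by
      obtain ⟨r, hr, h | h⟩ := key y hy
      · exact absurd (h (Metric.mem_ball_self hr)) hyA
      · exact mem_interior.2 ⟨_, h, Metric.isOpen_ball, Metric.mem_ball_self hr⟩⟩
  exact interior_subset hv2 (interior_subset hv1)

/-- An escaping orbit visits a compact subset of `ℂ*` only finitely often. -/
theorem exists_forall_iterate_notMem {z : ℂ} (hz : z ∈ escapingSet f) {K : Set ℂ}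
    (hK : IsCompact K) (hK0 : K ⊆ {0}ᶜ) : ∃ N, ∀ n ≥ N, f^[n] z ∉ K := by
  obtain ⟨R, hR⟩ := hK.isBounded.exists_norm_le
  obtain ⟨ε, hε, hεK⟩ := Metric.mem_nhds_iff.1 (hK.isClosed.isOpen_compl.mem_nhds
    (show (0 : ℂ) ∈ Kᶜ from fun h => hK0 h rfl))
  have hR1 : 0 < max R 1 := lt_max_of_lt_right one_pos
  obtain ⟨N, hN⟩ := hz.2 (min ε (1 / max R 1)) (by positivity)
  refine ⟨N, fun n hn hnK => ?_⟩
  rcases hN n hn with h | h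
  · exact hεK (mem_ball_zero_iff.2 (h.trans_le (min_le_left _ _))) hnK
  · have h1 : max R 1 ≤ 1 / min ε (1 / max R 1) := by
      rw [le_div_iff₀ (by positivity), mul_comm, ← le_div_iff₀ hR1]
      exact min_le_right _ _
    linarith [hR _ hnK, le_max_left R 1]

/-- Let `U ⊆ I_e(f)` be open and connected with compact closure in `ℂ*`, and suppose that no
boundary point of `U` lies in `I_e(f)`. Then the iterated images of `U` are pairwise disjoint. -/
theorem disjoint_image_iterate (hf0 : ∀ z, z ≠ 0 → f z ≠ 0) (hfa : AnalyticOnNhd ℂ f {0}ᶜ)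
    {U : Set ℂ} (hUc : IsPreconnected U)
    (hopen : ∀ n, IsOpen (f^[n] '' U)) (hK : IsCompact (closure U)) (hK0 : closure U ⊆ {0}ᶜ)
    (hUI : U ⊆ littleEscapingSet f e) (hclU : closure U ∩ littleEscapingSet f e ⊆ U)
    {m n : ℕ} (hmn : m < n) : Disjoint (f^[m] '' U) (f^[n] '' U) := by
  have hcont : ∀ n, ContinuousOn f^[n] (closure U) := fun n =>
    (analyticOnNhd_iterate hf0 hfa n).continuousOn.mono hK0
  have hcpt : ∀ n, IsCompact (f^[n] '' closure U) := fun n => hK.image_of_continuousOn (hcont n)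
  have hVI : ∀ n, f^[n] '' U ⊆ littleEscapingSet f e := by
    rintro n _ ⟨w, hw, rfl⟩
    exact (iterate_mem_littleEscapingSet hf0 (hK0 (subset_closure hw)) n).2 (hUI hw)
  have hsub : ∀ i j, (f^[i] '' U ∩ f^[j] '' U).Nonempty → f^[i] '' U ⊆ f^[j] '' U := by
    intro i j hij
    refine (hUc.image _ ((hcont i).mono subset_closure)).subset_left_of_subset_union (hopen j)
      (hcpt j).isClosed.isOpen_compl ?_ ?_ hij
    · exact disjoint_compl_right.mono_left (image_mono subset_closure)
    · intro v hv
      by_cases h : v ∈ f^[j] '' closure U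
      · obtain ⟨w, hw, rfl⟩ := h
        exact Or.inl ⟨w, hclU ⟨hw, (iterate_mem_littleEscapingSet hf0 (hK0 hw) j).1
          (hVI i hv)⟩, rfl⟩
      · exact Or.inr h
  rw [Set.disjoint_iff_inter_eq_empty, ← not_nonempty_iff_eq_empty]
  intro hne
  have hnm : f^[n] '' U ⊆ f^[m] '' U := hsub n m (by rwa [inter_comm])
  obtain ⟨v, hv, -⟩ := hne
  have hmaps : MapsTo f^[n - m] (f^[m] '' U) (f^[m] '' U) := by
    rintro _ ⟨w, hw, rfl⟩
    rw [← iterate_add_apply, Nat.sub_add_cancel hmn.le]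
    exact hnm ⟨w, hw, rfl⟩
  obtain ⟨N, hN⟩ := exists_forall_iterate_notMem (hVI m hv).1 (hcpt m) (by
    rintro _ ⟨w, hw, rfl⟩
    exact iterate_ne_zero hf0 m (hK0 hw))
  refine hN ((n - m) * N) (Nat.le_mul_of_pos_left N (by omega)) ?_
  rw [iterate_mul]
  exact image_mono subset_closure (hmaps.iterate N hv)

end Escaping

/-- A transcendental self-map of `ℂ*` with an escaping point is an open map on `ℂ*`. -/
theorem IsTranscendentalSelfMapCStar.isOpen_image {f : ℂ → ℂ}
    (hf : IsTranscendentalSelfMapCStar f) {z : ℂ} (hz : z ∈ escapingSet f) :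
    ∀ s ⊆ ({0}ᶜ : Set ℂ), IsOpen s → IsOpen (f '' s) := by
  have hf0 : ∀ z, z ≠ 0 → f z ≠ 0 := fun _ => hf.apply_ne_zero
  refine (hf.analyticOnNhd.is_constant_or_isOpen
    (isConnected_compl_singleton_of_one_lt_rank (by simp) 0).isPreconnected).resolve_left ?_
  rintro ⟨c, hc⟩
  obtain ⟨N, hN⟩ := exists_forall_iterate_notMem hz (K := {c}) isCompact_singleton (by
    rintro _ rfl
    exact (hc z hz.1) ▸ hf0 z hz.1)
  refine hN (N + 1) (by omega) ?_
  rw [iterate_succ_apply']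
  exact hc _ (iterate_ne_zero hf0 N hz.1)

/-- Any connected component of `I_e(f)` which is bounded in `ℂ*`
meets the Julia set `J(f)`. -/
theorem bounded_component_of_littleEscapingSet_meets_JuliaSet (f : ℂ → ℂ)
    (hf : IsTranscendentalSelfMapCStar f) (e : ℕ → Bool) (z : ℂ)
    (hz : z ∈ littleEscapingSet f e)
    (hbdd : BoundedInCStar (connectedComponentIn (littleEscapingSet f e) z)) :
    (connectedComponentIn (littleEscapingSet f e) z ∩ JuliaSet f).Nonempty := by
  by_contra hempty
  rw [not_nonempty_iff_eq_empty] at hempty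
  have hf0 : ∀ z, z ≠ 0 → f z ≠ 0 := fun _ => hf.apply_ne_zero
  have hfa := hf.analyticOnNhd
  have hfo := hf.isOpen_image hz.1
  have hCF : connectedComponentIn (littleEscapingSet f e) z ⊆ FatouSet f := by
    intro w hw
    by_contra hwF
    have : w ∈ connectedComponentIn (littleEscapingSet f e) z ∩ JuliaSet f :=
      ⟨hw, (connectedComponentIn_subset _ _ hw).1.1, hwF⟩
    rwa [hempty] at this
  have hzF : z ∈ FatouSet f := hCF (mem_connectedComponentIn hz)
  set U := connectedComponentIn (FatouSet f) z with hU
  have hUo : IsOpen U := (isOpen_FatouSet f).connectedComponentIn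
  have hUc : IsPreconnected U := isPreconnected_connectedComponentIn
  have hzU : z ∈ U := mem_connectedComponentIn hzF
  have hUF : U ⊆ FatouSet f := connectedComponentIn_subset _ _
  have hzlim := tendsto_normalizedIterate_self hf0 hz.1
  have hUI : U ⊆ littleEscapingSet f e := fun w hw =>
    mem_littleEscapingSet_of_tendsto hf0 hz (hUF hw).1
      (tendsto_normalizedIterate_of_mem_preconnected hf0 hfa hUF hUc hzU hzlim hw)
  have hUC := hUc.subset_connectedComponentIn hzU hUI
  have hCU : connectedComponentIn (littleEscapingSet f e) z ⊆ U :=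
    isPreconnected_connectedComponentIn.subset_connectedComponentIn
      (mem_connectedComponentIn hz) hCF
  obtain ⟨r, R, hr, -, hrR⟩ := hbdd
  have hclrR : closure U ⊆ {w : ℂ | r ≤ ‖w‖ ∧ ‖w‖ ≤ R} :=
    closure_minimal (hUC.trans hrR) ((isClosed_le continuous_const continuous_norm).inter
      (isClosed_le continuous_norm continuous_const))
  have hcl0 : closure U ⊆ {0}ᶜ := fun w hw => norm_pos_iff.1 (hr.trans_le (hclrR hw).1)
  have hUb : Bornology.IsBounded U :=
    isBounded_iff_forall_norm_le.2 ⟨R, fun w hw => (hclrR (subset_closure hw)).2⟩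
  have hclU : closure U ∩ littleEscapingSet f e ⊆ U := by
    rintro ζ ⟨hζ, hζI⟩
    have hc : IsPreconnected (insert ζ U) :=
      hUc.subset_closure (subset_insert _ _) (insert_subset hζ subset_closure)
    exact hCU (hc.subset_connectedComponentIn (mem_insert_of_mem _ hzU)
      (insert_subset hζI hUI) (mem_insert _ _))
  have hU0 : U ⊆ {0}ᶜ := subset_closure.trans hcl0
  have hlt : ∀ m n : ℕ, m < n → Disjoint (f^[m] '' U) (f^[n] '' U) := fun m n =>
    disjoint_image_iterate hf0 hfa hUc (isOpen_image_iterate hf0 hfo hU0 hUo)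
      hUb.isCompact_closure hcl0 hUI hclU
  have hdisj : ∀ m n : ℕ, m ≠ n → Disjoint (f^[m] '' U) (f^[n] '' U) := fun m n hmn =>
    hmn.lt_or_gt.elim (hlt m n) fun h => (hlt n m h).symm
  have hopen := isOpen_image_normalizedIterate hf0 hfo hU0 hUo z
  obtain ⟨ζ, ⟨hζ, hζU⟩, hζlim⟩ := exists_boundary_tendsto_norm_atTop hUo hUb
    (fun n => (analyticOnNhd_normalizedIterate hf0 hfa z n).mono hcl0)
    (fun n w hw => normalizedIterate_ne_zero hf0 z n (hcl0 hw)) hopen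
    (summable_volume_arcAngles hopen (fun n => 1 < ‖f^[n] z‖)
      fun m n hmn h => disjoint_image_normalizedIterate h (hdisj m n hmn))
    hzU hzlim
  exact hζU (hclU ⟨hζ, mem_littleEscapingSet_of_tendsto hf0 hz (hcl0 hζ) hζlim⟩)
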